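/- For every p ∈ [0,1], the 3-dimensional Grimmett random-orientation model on Z³ percolates: θ_G^3(p) > 0, i.e. with strictly positive probability there exists an infinite directed self-avoiding path starting at the origin. -/

import Mathlib

open MeasureTheory ENNReal

namespace RandomOrientation

/-- One step of the base-`(p, 1-p)` expansion map on `[0,1)`. -/
noncomputable def expand (p x : ℝ) : ℝ := if x < p then x / p else (x - p) / (1 - p)

/-- The `n`-th digit of the Bernoulli(`p`) expansion of `x`: for `x` uniformly
distributed on `[0,1)` the digits are i.i.d. `{true, false}`-valued with
`P(true) = p`. -/
noncomputable def bernDigit (p : ℝ) (n : ℕ) (x : ℝ) : Bool :=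
  decide ((expand p)^[n] x < p)

/-- The product over the countable index set `I` of Bernoulli(`p`) measures on
`Bool` (`P(true) = p`), realized as the joint distribution of the digits of the
Bernoulli(`p`) expansion of a uniform random point of `[0,1)`. -/
noncomputable def bernoulliProduct (I : Type*) [Encodable I] (p : ℝ) :
    Measure (I → Bool) :=
  Measure.map (fun x i => bernDigit p (Encodable.encode i) x)
    (volume.restrict (Set.Ico (0 : ℝ) 1))

/-- Edges of `ℤ³`: `(v, i)` is the edge from `v` to `v + eᵢ`. -/
abbrev Edge3 : Type := (ℤ × ℤ × ℤ) × Fin 3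

/-- An orientation configuration of the edges of `ℤ³`. -/
abbrev Config3 : Type := Edge3 → Bool

def e3Src (e : Edge3) : ℤ × ℤ × ℤ := e.1

def e3Dst (e : Edge3) : ℤ × ℤ × ℤ :=
  if e.2 = 0 then (e.1.1 + 1, e.1.2.1, e.1.2.2)
  else if e.2 = 1 then (e.1.1, e.1.2.1 + 1, e.1.2.2)
  else (e.1.1, e.1.2.1, e.1.2.2 + 1)

/-- The law of the `3`-dimensional random orientation with parameter `p`: each
edge independently carries the bit `true` with probability `p`. -/
noncomputable def mu3 (p : ℝ) : Measure Config3 := bernoulliProduct Edge3 p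

/-- The directed-edge relation of the `3`-dimensional Grimmett model:
`ω e = true` means `e` is oriented in the positive coordinate direction,
`ω e = false` in the negative one. -/
def gStep3 (ω : Config3) (u v : ℤ × ℤ × ℤ) : Prop :=
  ∃ e : Edge3, (e3Src e = u ∧ e3Dst e = v ∧ ω e = true) ∨
    (e3Src e = v ∧ e3Dst e = u ∧ ω e = false)

/-- There is an infinite directed self-avoiding path starting at the origin,
all of whose vertices lie in `S`, for the directed-step relation `R`. -/
def percolates3 (R : ℤ × ℤ × ℤ → ℤ × ℤ × ℤ → Prop) (S : Set (ℤ × ℤ × ℤ)) : Prop :=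
  ∃ γ : ℕ → ℤ × ℤ × ℤ, γ 0 = (0, 0, 0) ∧ Function.Injective γ ∧
    (∀ n, R (γ n) (γ (n + 1))) ∧ ∀ n, γ n ∈ S

/-- The slab `ℤ² × {-1, 0, 1}`. -/
def slab : Set (ℤ × ℤ × ℤ) := {v | v.2.2 = -1 ∨ v.2.2 = 0 ∨ v.2.2 = 1}

/-! ### Cylinder probabilities -/

/-- The weight that a Bernoulli(`p`) bit gives to a value. -/
noncomputable def bitWeight (p : ℝ) (b : Bool) : ℝ≥0∞ :=
  if b then ENNReal.ofReal p else ENNReal.ofReal (1 - p)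

theorem bitWeight_true_add_false {p : ℝ} (hp0 : 0 ≤ p) (hp1 : p ≤ 1) :
    bitWeight p true + bitWeight p false = 1 := by
  simp only [bitWeight, if_true, Bool.false_eq_true, if_false]
  rw [← ENNReal.ofReal_add hp0 (by linarith)]
  simp

theorem measurable_expand (p : ℝ) : Measurable (expand p) := by
  unfold expand
  exact Measurable.ite measurableSet_Iio (by fun_prop) (by fun_prop)

theorem measurable_bernDigit (p : ℝ) (n : ℕ) : Measurable (bernDigit p n) := by
  have h : Measurable fun x => (expand p)^[n] x := (measurable_expand p).iterate n
  refine measurable_to_bool ?_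
  have : bernDigit p n ⁻¹' {true} = {x | (expand p)^[n] x < p} := by
    ext x; simp [bernDigit]
  rw [this]
  exact measurableSet_lt h measurable_const

theorem volume_affine_preimage {c : ℝ} (hc : 0 ≤ c) (a : ℝ) {E : Set ℝ} (hE : E ⊆ Set.Ico 0 1) :
    volume {x | x ∈ Set.Ico a (a + c) ∧ (x - a) / c ∈ E} = ENNReal.ofReal c * volume E := by
  rcases hc.eq_or_lt with rfl | hc
  · simp
  · have h : {x | x ∈ Set.Ico a (a + c) ∧ (x - a) / c ∈ E}
        = (fun x => x + -a) ⁻¹' ((· * c⁻¹) ⁻¹' E) := by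
      ext x
      simp only [Set.mem_ofPred_eq, Set.mem_preimage, ← sub_eq_add_neg, ← div_eq_mul_inv]
      refine ⟨fun hx => hx.2, fun hx => ⟨?_, hx⟩⟩
      have := hE hx
      rw [Set.mem_Ico, le_div_iff₀ hc, div_lt_iff₀ hc] at this
      constructor <;> linarith [this.1, this.2]
    rw [h, measure_preimage_add_right, Real.volume_preimage_mul_right (inv_ne_zero hc.ne')]
    simp [abs_of_pos hc]

theorem expand_mem_Ico {p x : ℝ} (hx : x ∈ Set.Ico (0 : ℝ) 1) : expand p x ∈ Set.Ico (0 : ℝ) 1 := by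
  unfold expand
  obtain ⟨h0, h1⟩ := hx
  split_ifs with h
  · have hp : 0 < p := by linarith
    exact ⟨by positivity, (div_lt_one hp).2 h⟩
  · push Not at h
    have hp : 0 < 1 - p := by linarith
    exact ⟨div_nonneg (by linarith) hp.le, (div_lt_one hp).2 (by linarith)⟩

theorem bernDigit_zero_eq_true {p x : ℝ} : bernDigit p 0 x = true ↔ x < p :=
  decide_eq_true_iff

theorem bernDigit_zero_eq_false {p x : ℝ} : bernDigit p 0 x = false ↔ p ≤ x :=
  decide_eq_false_iff_not.trans not_lt

theorem bernDigit_succ (p : ℝ) (n : ℕ) (x : ℝ) :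
    bernDigit p (n + 1) x = bernDigit p n (expand p x) := by
  unfold bernDigit
  rw [Function.iterate_succ_apply]

theorem volume_first_digit {p : ℝ} (hp0 : 0 ≤ p) (hp1 : p ≤ 1) {E : Set ℝ}
    (hE : E ⊆ Set.Ico 0 1) (b : Bool) :
    volume {x | x ∈ Set.Ico (0 : ℝ) 1 ∧ bernDigit p 0 x = b ∧ expand p x ∈ E}
      = bitWeight p b * volume E := by
  cases b
  · rw [bitWeight, if_neg (by simp), ← volume_affine_preimage (by linarith) p hE]
    congr 1
    ext x
    simp only [bernDigit_zero_eq_false, Set.mem_ofPred_eq, Set.mem_Ico, add_sub_cancel, expand]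
    constructor
    · rintro ⟨h, h', h''⟩
      rw [if_neg (not_lt.2 h')] at h''
      exact ⟨⟨h', h.2⟩, h''⟩
    · rintro ⟨h, h'⟩
      rw [if_neg (not_lt.2 h.1)]
      exact ⟨⟨hp0.trans h.1, h.2⟩, h.1, h'⟩
  · rw [bitWeight, if_pos rfl, ← volume_affine_preimage hp0 0 hE]
    congr 1
    ext x
    simp only [bernDigit_zero_eq_true, Set.mem_ofPred_eq, Set.mem_Ico, zero_add, sub_zero, expand]
    constructor
    · rintro ⟨h, h', h''⟩
      rw [if_pos h'] at h''
      exact ⟨⟨h.1, h'⟩, h''⟩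
    · rintro ⟨h, h'⟩
      rw [if_pos h.2]
      exact ⟨⟨h.1, h.2.trans_le hp1⟩, h.2, h'⟩

open Classical in
theorem volume_digits {p : ℝ} (hp0 : 0 ≤ p) (hp1 : p ≤ 1) (n : ℕ) (A : Set ℕ) (d : ℕ → Bool) :
    volume {x | x ∈ Set.Ico (0 : ℝ) 1 ∧ ∀ i < n, i ∈ A → bernDigit p i x = d i}
      = ∏ i ∈ Finset.range n, if i ∈ A then bitWeight p (d i) else 1 := by
  induction n generalizing A d with
  | zero =>
    have : {x | x ∈ Set.Ico (0 : ℝ) 1 ∧ ∀ i < 0, i ∈ A → bernDigit p i x = d i}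
        = Set.Ico 0 1 := by
      ext x; simp
    rw [this]; simp
  | succ n ih =>
    specialize ih {i | i + 1 ∈ A} (fun i => d (i + 1))
    set E := {x | x ∈ Set.Ico (0 : ℝ) 1 ∧ ∀ i < n, i ∈ {i | i + 1 ∈ A} →
      bernDigit p i x = d (i + 1)} with hE
    have hEI : E ⊆ Set.Ico 0 1 := fun x hx => hx.1
    have key : ∀ x ∈ Set.Ico (0 : ℝ) 1, (∀ i < n + 1, i ∈ A → bernDigit p i x = d i) ↔
        ((0 ∈ A → bernDigit p 0 x = d 0) ∧ expand p x ∈ E) := by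
      intro x hx
      rw [Nat.forall_lt_succ_left]
      simp only [hE, Set.mem_ofPred_eq, expand_mem_Ico hx, true_and, bernDigit_succ]
    rw [Finset.prod_range_succ']
    have ih' : (∏ i ∈ Finset.range n, if i + 1 ∈ A then bitWeight p (d (i + 1)) else 1)
      = volume E := ih.symm
    rw [ih', mul_comm]
    by_cases h0 : 0 ∈ A
    · rw [if_pos h0, ← volume_first_digit hp0 hp1 hEI]
      congr 1
      ext x
      simp only [Set.mem_ofPred_eq]
      refine and_congr_right fun hx => ?_
      rw [key x hx]
      simp [h0]
    · rw [if_neg h0, ← bitWeight_true_add_false hp0 hp1, add_mul,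
        ← volume_first_digit hp0 hp1 hEI, ← volume_first_digit hp0 hp1 hEI,
        ← measure_inter_add_sdiff _ (measurable_bernDigit p 0 (MeasurableSet.singleton true))]
      congr 2
      all_goals
        ext x
        simp only [Set.mem_inter_iff, Set.mem_sdiff, Set.mem_preimage, Set.mem_singleton_iff,
          Set.mem_ofPred_eq, Bool.not_eq_true]
        constructor
        · rintro ⟨⟨hx, h⟩, h'⟩
          exact ⟨hx, h', ((key x hx).1 h).2⟩
        · rintro ⟨hx, h, h'⟩
          exact ⟨⟨hx, (key x hx).2 ⟨fun h => absurd h h0, h'⟩⟩, h⟩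

theorem measurable_digits (I : Type*) [Encodable I] (p : ℝ) :
    Measurable fun (x : ℝ) (i : I) => bernDigit p (Encodable.encode i) x :=
  measurable_pi_lambda _ fun _ => measurable_bernDigit p _

/-- The configurations that agree with `η` on `H`. -/
def cylinder {I : Type*} (H : Finset I) (η : I → Bool) : Set (I → Bool) :=
  {ω | ∀ h ∈ H, ω h = η h}

theorem measurableSet_cylinder {I : Type*} (H : Finset I) (η : I → Bool) :
    MeasurableSet (cylinder H η) := by
  have : cylinder H η = ⋂ h ∈ H, (fun ω : I → Bool => ω h) ⁻¹' {η h} := by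
    ext ω; simp [cylinder]
  rw [this]
  exact H.measurableSet_biInter fun h _ => measurable_pi_apply h (MeasurableSet.singleton _)

theorem bernoulliProduct_cylinder {I : Type*} [Encodable I] {p : ℝ} (hp0 : 0 ≤ p) (hp1 : p ≤ 1)
    (H : Finset I) (η : I → Bool) :
    bernoulliProduct I p (cylinder H η) = ∏ h ∈ H, bitWeight p (η h) := by
  classical
  rw [bernoulliProduct, Measure.map_apply (measurable_digits I p) (measurableSet_cylinder H η),
    Measure.restrict_apply (measurable_digits I p (measurableSet_cylinder H η))]
  set d : ℕ → Bool := fun n => ((Encodable.decode n : Option I).map η).getD false with hd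
  have hdη : ∀ h, d (Encodable.encode h) = η h := by simp [hd]
  set A := H.image Encodable.encode with hA
  obtain ⟨n, hn⟩ : ∃ n, ∀ i ∈ A, i < n :=
    ⟨A.sup id + 1, fun i hi => Nat.lt_succ_of_le (Finset.le_sup (f := id) hi)⟩
  have h1 : (fun (x : ℝ) (i : I) => bernDigit p (Encodable.encode i) x) ⁻¹' cylinder H η ∩
      Set.Ico 0 1 = {x | x ∈ Set.Ico (0 : ℝ) 1 ∧ ∀ i < n, i ∈ (A : Set ℕ) →
        bernDigit p i x = d i} := by
    ext x
    simp only [cylinder, Set.mem_inter_iff, Set.mem_preimage, Set.mem_ofPred_eq, Finset.mem_coe]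
    rw [and_comm]
    refine and_congr_right fun _ => ⟨fun h i _ hi => ?_, fun h e he => ?_⟩
    · obtain ⟨e, he, rfl⟩ := Finset.mem_image.1 hi
      rw [hdη, h e he]
    · have he' := Finset.mem_image_of_mem Encodable.encode he
      rw [h _ (hn _ he') he', hdη]
  rw [h1, volume_digits hp0 hp1]
  simp only [Finset.mem_coe]
  rw [← Finset.prod_filter]
  have h2 : (Finset.range n).filter (· ∈ A) = A := by
    ext i
    simp only [Finset.mem_filter, Finset.mem_range, and_iff_right_iff_imp]
    exact hn i
  rw [h2, hA, Finset.prod_image (fun _ _ _ _ h => Encodable.encode_injective h)]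
  simp [hdη]

theorem mu3_cylinder_insert {p : ℝ} (hp0 : 0 ≤ p) (hp1 : p ≤ 1) {H : Finset Edge3} {e : Edge3}
    (he : e ∉ H) (η : Config3) (b : Bool) :
    mu3 p (cylinder (insert e H) (Function.update η e b))
      = bitWeight p b * mu3 p (cylinder H η) := by
  rw [mu3, bernoulliProduct_cylinder hp0 hp1, bernoulliProduct_cylinder hp0 hp1,
    Finset.prod_insert he, Function.update_self]
  congr 1
  refine Finset.prod_congr rfl fun h hh => ?_
  rw [Function.update_of_ne (ne_of_mem_of_not_mem hh he)]

/-! ### Infinite self-avoiding paths -/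

section Konig

variable {α : Type*} {R : α → α → Prop}

/-- The vertices reachable from `u` by steps that never enter `A`. -/
def reachAvoiding (R : α → α → Prop) (A : Set α) (u : α) : Set α :=
  {v | Relation.ReflTransGen (fun x y => R x y ∧ y ∉ A) u v}

theorem reachAvoiding_insert_self (A : Set α) (u : α) :
    reachAvoiding R A u ⊆ reachAvoiding R (insert u A) u := by
  intro v hv
  induction hv with
  | refl => exact Relation.ReflTransGen.refl
  | @tail y z _ hyz ih =>
    by_cases hz : z = u
    · subst hz; exact Relation.ReflTransGen.refl
    · exact Relation.ReflTransGen.tail ih ⟨hyz.1, by simp [hz, hyz.2]⟩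

theorem exists_step_reachAvoiding_infinite (hfin : ∀ u, {v | R u v}.Finite) {A : Set α} {u : α}
    (h : (reachAvoiding R A u).Infinite) :
    ∃ v, R u v ∧ v ∉ A ∧ (reachAvoiding R (insert v A) v).Infinite := by
  by_contra! hcon
  refine h ?_
  have hsub : reachAvoiding R A u ⊆
      {u} ∪ ⋃ v ∈ {v | R u v ∧ v ∉ A}, reachAvoiding R (insert v A) v := by
    intro w hw
    rcases Relation.ReflTransGen.cases_head hw with rfl | ⟨v, huv, hvw⟩
    · exact Or.inl rfl
    · exact Or.inr (Set.mem_biUnion huv (reachAvoiding_insert_self A v hvw))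
  refine Set.Finite.subset ((Set.finite_singleton u).union ?_) hsub
  refine Set.Finite.biUnion ((hfin u).subset fun v hv => hv.1) fun v hv => ?_
  exact Set.not_infinite.1 fun hinf => hinf (hcon v hv.1 hv.2)

theorem exists_injective_path (hfin : ∀ u, {v | R u v}.Finite) {a : α}
    (h : {v | Relation.ReflTransGen R a v}.Infinite) :
    ∃ γ : ℕ → α, γ 0 = a ∧ Function.Injective γ ∧ ∀ n, R (γ n) (γ (n + 1)) := by
  let T := {x : Set α × α // x.2 ∈ x.1 ∧ (reachAvoiding R x.1 x.2).Infinite}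
  have hnext : ∀ x : T, ∃ y : T, R x.1.2 y.1.2 ∧ y.1.2 ∉ x.1.1 ∧ x.1.1 ⊆ y.1.1 := by
    rintro ⟨⟨A, u⟩, _, hinf⟩
    obtain ⟨v, huv, hvA, hv⟩ := exists_step_reachAvoiding_infinite hfin hinf
    exact ⟨⟨⟨insert v A, v⟩, Set.mem_insert _ _, hv⟩, huv, hvA, Set.subset_insert _ _⟩
  choose f hfR hfn hfs using hnext
  have h0 : (reachAvoiding R {a} a).Infinite := by
    refine Set.Infinite.mono ?_ h
    intro v hv
    have := reachAvoiding_insert_self (R := R) ∅ a (by simpa [reachAvoiding] using hv)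
    simpa using this
  let s : ℕ → T := fun n => f^[n] ⟨⟨{a}, a⟩, rfl, h0⟩
  have hs : ∀ n, s (n + 1) = f (s n) := fun n => Function.iterate_succ_apply' f n _
  have hmono : Monotone fun n => (s n).1.1 :=
    monotone_nat_of_le_succ fun n => by rw [hs]; exact hfs _
  refine ⟨fun n => (s n).1.2, rfl, Function.Injective.of_lt_imp_ne fun m n hmn heq => ?_, fun n => ?_⟩
  · obtain ⟨k, rfl⟩ := Nat.exists_eq_add_of_lt hmn
    have h1 : (s m).1.2 ∈ (s (m + k)).1.1 := hmono (Nat.le_add_right m k) (s m).2.1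
    have h2 := hfn (s (m + k))
    rw [← hs] at h2
    exact h2 (heq ▸ h1)
  · change R (s n).1.2 (s (n + 1)).1.2
    rw [hs]; exact hfR _

end Konig

theorem gStep3_finite (ω : Config3) (u : ℤ × ℤ × ℤ) : {v | gStep3 ω u v}.Finite := by
  have : {v | gStep3 ω u v} ⊆ (Set.Icc (u - (1, 1, 1)) (u + (1, 1, 1))) := by
    rintro v ⟨⟨⟨x, y, z⟩, i⟩, h⟩
    obtain ⟨a, b, c⟩ := u
    obtain ⟨a', b', c'⟩ := v
    simp only [e3Src, e3Dst] at h
    simp only [Set.mem_Icc, Prod.mk_sub_mk, Prod.mk_add_mk, Prod.mk_le_mk]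
    split_ifs at h <;> simp only [Prod.mk.injEq] at h <;> omega
  exact (Set.finite_Icc _ _).subset this

theorem percolates3_of_infinite {ω : Config3}
    (h : {v | Relation.ReflTransGen (gStep3 ω) (0, 0, 0) v}.Infinite) :
    percolates3 (gStep3 ω) Set.univ := by
  obtain ⟨γ, h0, hinj, hstep⟩ := exists_injective_path (gStep3_finite ω) h
  exact ⟨γ, h0, hinj, hstep, fun _ => Set.mem_univ _⟩

/-! ### The triangular lattice and its boundary arcs -/

/-- The six unit vectors of the triangular lattice, in counterclockwise order. -/
def dir : Fin 6 → ℤ × ℤ := ![(1, 0), (1, 1), (0, 1), (-1, 0), (-1, -1), (0, -1)]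

/-- A directed edge of the triangular lattice: a base vertex with a direction. -/
abbrev Arc : Type := (ℤ × ℤ) × Fin 6

/-- The head of an arc. -/
def Arc.tip (s : Arc) : ℤ × ℤ := s.1 + dir s.2

theorem dir_add_two (k : Fin 6) : dir (k + 2) = dir (k + 1) - dir k := by
  revert k; decide

theorem dir_add_three (k : Fin 6) : dir (k + 3) = -dir k := by
  revert k; decide

theorem dir_sub_one (k : Fin 6) : dir (k - 1) = dir k - dir (k + 1) := by
  revert k; decide

theorem dir_sub_two (k : Fin 6) : dir (k - 2) = -dir (k + 1) := by
  revert k; decide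

/-- The arc that leaves the same triangle, turning left around the base (`false`) or around
the tip (`true`). -/
def turn (b : Bool) (s : Arc) : Arc :=
  if b then (s.1 + dir (s.2 + 1), s.2 - 1) else (s.1, s.2 + 1)

/-- The arcs pointing out of `S`. -/
def outArcs (S : Set (ℤ × ℤ)) : Set Arc := {s | s.1 ∈ S ∧ s.tip ∉ S}

open Classical in
/-- The side to which the boundary of `S` turns after the arc `s`. -/
noncomputable def side (S : Set (ℤ × ℤ)) (s : Arc) : Bool := decide (s.1 + dir (s.2 + 1) ∈ S)

/-- The successor of an arc along the boundary of `S`. -/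
noncomputable def next (S : Set (ℤ × ℤ)) (s : Arc) : Arc := turn (side S s) s

theorem next_of_mem {S : Set (ℤ × ℤ)} {s : Arc} (h : s.1 + dir (s.2 + 1) ∈ S) :
    next S s = (s.1 + dir (s.2 + 1), s.2 - 1) := by
  simp [next, side, turn, h]

theorem next_of_notMem {S : Set (ℤ × ℤ)} {s : Arc} (h : s.1 + dir (s.2 + 1) ∉ S) :
    next S s = (s.1, s.2 + 1) := by
  simp [next, side, turn, h]

theorem next_mem_outArcs {S : Set (ℤ × ℤ)} {s : Arc} (hs : s ∈ outArcs S) :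
    next S s ∈ outArcs S := by
  by_cases h : s.1 + dir (s.2 + 1) ∈ S
  · rw [next_of_mem h]
    refine ⟨h, ?_⟩
    simp only [Arc.tip, dir_sub_one]
    rw [add_add_sub_cancel]
    exact hs.2
  · rw [next_of_notMem h]
    exact ⟨hs.1, h⟩

theorem next_injOn (S : Set (ℤ × ℤ)) : Set.InjOn (next S) (outArcs S) := by
  classical
  let prev : Arc → Arc := fun s =>
    if s.1 + dir (s.2 - 1) ∈ S then (s.1 + dir (s.2 - 1), s.2 + 1) else (s.1, s.2 - 1)
  refine Set.LeftInvOn.injOn (f₁' := prev) fun s hs => ?_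
  by_cases h : s.1 + dir (s.2 + 1) ∈ S
  · have h2 : s.2 - 1 - 1 = s.2 - 2 := by rw [sub_sub]; rfl
    simp [next_of_mem h, prev, h2, dir_sub_two, hs.1]
  · have := hs.2
    simp only [Arc.tip] at this
    simp [next_of_notMem h, prev, this]

theorem outArcs_finite {S : Set (ℤ × ℤ)} (hS : S.Finite) : (outArcs S).Finite :=
  (hS.prod (Set.finite_univ (α := Fin 6))).subset fun _ hs => ⟨hs.1, Set.mem_univ _⟩

theorem iterate_next_mem_outArcs {S : Set (ℤ × ℤ)} {r : Arc} (hr : r ∈ outArcs S) (i : ℕ) :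
    (next S)^[i] r ∈ outArcs S := by
  induction i with
  | zero => exact hr
  | succ i ih => rw [Function.iterate_succ_apply']; exact next_mem_outArcs ih

theorem mem_periodicPts_next {S : Set (ℤ × ℤ)} (hS : S.Finite) {r : Arc} (hr : r ∈ outArcs S) :
    r ∈ Function.periodicPts (next S) := by
  have : Finite (outArcs S) := outArcs_finite hS
  let F : outArcs S → outArcs S := fun s => ⟨next S s, next_mem_outArcs s.2⟩
  have hF : Function.Injective F := fun a b h =>
    Subtype.ext (next_injOn S a.2 b.2 (congrArg Subtype.val h))
  obtain ⟨n, hn, hp⟩ := hF.mem_periodicPts ⟨r, hr⟩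
  have hsc : Function.Semiconj (Subtype.val : outArcs S → Arc) F (next S) := fun _ => rfl
  refine ⟨n, hn, ?_⟩
  have h1 := (hsc.iterate_right n) ⟨r, hr⟩
  rw [hp.eq] at h1
  exact h1.symm

/-- The boundary circuit of `S` through the arc `r`. -/
def orbit (S : Set (ℤ × ℤ)) (r : Arc) : Set Arc := {s | ∃ i, (next S)^[i] r = s}

theorem orbit_subset_outArcs {S : Set (ℤ × ℤ)} {r : Arc} (hr : r ∈ outArcs S) :
    orbit S r ⊆ outArcs S := by
  rintro s ⟨i, rfl⟩
  exact iterate_next_mem_outArcs hr i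

theorem next_mem_orbit_iff {S : Set (ℤ × ℤ)} (hS : S.Finite) {r : Arc} (hr : r ∈ outArcs S)
    {s : Arc} (hs : s ∈ outArcs S) : next S s ∈ orbit S r ↔ s ∈ orbit S r := by
  constructor
  · rintro ⟨i, hi⟩
    obtain ⟨n, hn, hp⟩ := mem_periodicPts_next hS hr
    refine ⟨i + (n - 1), next_injOn S (iterate_next_mem_outArcs hr _) hs ?_⟩
    rw [← Function.iterate_succ_apply' (next S), ← hi, Nat.succ_eq_add_one,
      show i + (n - 1) + 1 = i + n by omega, Function.iterate_add_apply, hp.eq]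
  · rintro ⟨i, rfl⟩
    exact ⟨i + 1, Function.iterate_succ_apply' _ _ _⟩

theorem mem_orbit_iff_lt {S : Set (ℤ × ℤ)} (hS : S.Finite) {r : Arc} (hr : r ∈ outArcs S)
    {s : Arc} (hs : s ∈ orbit S r) :
    ∃ i < Function.minimalPeriod (next S) r, (next S)^[i] r = s := by
  obtain ⟨i, rfl⟩ := hs
  exact ⟨i % Function.minimalPeriod (next S) r,
    Nat.mod_lt _ (Function.minimalPeriod_pos_of_mem_periodicPts (mem_periodicPts_next hS hr)),
    Function.iterate_mod_minimalPeriod_eq⟩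

/-! ### Boundary circuits separate -/

open Classical in
/-- The indicator, modulo two, that an edge is crossed by a set of arcs. -/
noncomputable def crossing (Γ : Set Arc) (s : Arc) : ZMod 2 :=
  if s ∈ Γ ∨ (s.tip, s.2 + 3) ∈ Γ then 1 else 0

open Classical in
theorem crossing_eq_ite {Γ : Set Arc} {s : Arc} {P : Prop} [Decidable P]
    (h : (s ∈ Γ ∨ (s.tip, s.2 + 3) ∈ Γ) ↔ P) : crossing Γ s = if P then 1 else 0 :=
  if_congr h rfl rfl

open Classical in
theorem crossing_reverse (Γ : Set Arc) (s : Arc) :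
    crossing Γ (s.tip, s.2 + 3) = crossing Γ s := by
  have h : (Arc.tip (s.tip, s.2 + 3), s.2 + 3 + 3) = s := by
    have h3 : s.2 + 3 + 3 = s.2 := by generalize s.2 = k; revert k; decide
    ext1
    · simp [Arc.tip, dir_add_three]
    · exact h3
  exact if_congr (by rw [or_comm, h]) rfl rfl

theorem crossing_eq_zero {S : Set (ℤ × ℤ)} {Γ : Set Arc} (hΓ : Γ ⊆ outArcs S) {s : Arc}
    (h : s.1 ∈ S ↔ s.tip ∈ S) : crossing Γ s = 0 := by
  have h' : Arc.tip (s.tip, s.2 + 3) = s.1 := by simp [Arc.tip, dir_add_three]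
  refine if_neg ?_
  rintro (hs | hs)
  · exact (hΓ hs).2 (h.1 (hΓ hs).1)
  · have := hΓ hs
    exact this.2 (h' ▸ h.2 this.1)

theorem crossing_triangle {S : Set (ℤ × ℤ)} {Γ : Set Arc} (hΓ : Γ ⊆ outArcs S)
    (hnext : ∀ s ∈ outArcs S, next S s ∈ Γ ↔ s ∈ Γ) (a : ℤ × ℤ) (k : Fin 6) :
    crossing Γ (a, k) + crossing Γ (a + dir k, k + 2) + crossing Γ (a, k + 1) = 0 := by
  have k23 : k + 2 + 3 = k + 5 := by rw [add_assoc]; rfl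
  have k13 : k + 1 + 3 = k + 4 := by rw [add_assoc]; rfl
  have k21 : k + 2 + 1 = k + 3 := by rw [add_assoc]; rfl
  have k2m : k + 2 - 1 = k + 1 := by revert k; decide
  have k41 : k + 4 + 1 = k + 5 := by rw [add_assoc]; rfl
  have k4m : k + 4 - 1 = k + 3 := by revert k; decide
  have k0m : k - 1 = k + 5 := by revert k; decide
  have d4 : dir (k + 4) = -dir (k + 1) := by revert k; decide
  have d5 : dir (k + 5) = dir k - dir (k + 1) := by revert k; decide
  have tbc : a + dir k + dir (k + 2) = a + dir (k + 1) := by rw [dir_add_two]; abel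
  have tba : a + dir k + dir (k + 3) = a := by rw [dir_add_three]; abel
  have tca : a + dir (k + 1) + dir (k + 4) = a := by rw [d4]; abel
  have tcb : a + dir (k + 1) + dir (k + 5) = a + dir k := by rw [d5]; abel
  have nab := hnext (a, k)
  have nbc := hnext (a + dir k, k + 2)
  have nca := hnext (a + dir (k + 1), k + 4)
  have oab := @hΓ (a, k)
  have oba := @hΓ (a + dir k, k + 3)
  have obc := @hΓ (a + dir k, k + 2)
  have ocb := @hΓ (a + dir (k + 1), k + 5)
  have oac := @hΓ (a, k + 1)
  have oca := @hΓ (a + dir (k + 1), k + 4)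
  simp only [outArcs, Arc.tip, Set.mem_ofPred_eq, tba, tbc, tca, tcb]
    at oab oba obc ocb oac oca nab nbc nca
  classical
  have rab := crossing_eq_ite (Γ := Γ) (s := (a, k)) Iff.rfl
  have rbc := crossing_eq_ite (Γ := Γ) (s := (a + dir k, k + 2))
    (P := (a + dir k, k + 2) ∈ Γ ∨ (a + dir (k + 1), k + 5) ∈ Γ) (by simp only [Arc.tip, tbc, k23])
  have rac := crossing_eq_ite (Γ := Γ) (s := (a, k + 1))
    (P := (a, k + 1) ∈ Γ ∨ (a + dir (k + 1), k + 4) ∈ Γ) (by simp only [Arc.tip, k13])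
  simp only [Arc.tip] at rab
  rw [rab, rbc, rac]
  have nab₁ : a + dir (k + 1) ∈ S → next S (a, k) = (a + dir (k + 1), k + 5) := fun h => by
    rw [next_of_mem h, k0m]
  have nab₀ : a + dir (k + 1) ∉ S → next S (a, k) = (a, k + 1) := fun h => next_of_notMem h
  have nbc₁ : a ∈ S → next S (a + dir k, k + 2) = (a, k + 1) := fun h => by
    rw [next_of_mem (by simpa only [k21, tba] using h), k21, tba, k2m]
  have nbc₀ : a ∉ S → next S (a + dir k, k + 2) = (a + dir k, k + 3) := fun h => by
    rw [next_of_notMem (by simpa only [k21, tba] using h), k21]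
  have nca₁ : a + dir k ∈ S → next S (a + dir (k + 1), k + 4) = (a + dir k, k + 3) := fun h => by
    rw [next_of_mem (by simpa only [k41, tcb] using h), k41, tcb, k4m]
  have nca₀ : a + dir k ∉ S → next S (a + dir (k + 1), k + 4) = (a + dir (k + 1), k + 5) :=
    fun h => by rw [next_of_notMem (by simpa only [k41, tcb] using h), k41]
  by_cases hA : a ∈ S <;> by_cases hB : a + dir k ∈ S <;> by_cases hC : a + dir (k + 1) ∈ S <;>
    simp_all [CharTwo.add_self_eq_zero]

section Separation

variable {S : Set (ℤ × ℤ)} {Γ : Set Arc} {B : ℤ}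

/-- The parity of the number of crossings of the horizontal ray from `u` to abscissa `B`. -/
noncomputable def winding (Γ : Set Arc) (B : ℤ) (u : ℤ × ℤ) : ZMod 2 :=
  ∑ j ∈ Finset.Ico u.1 B, crossing Γ ((j, u.2), 0)

theorem winding_add_right (hΓ : Γ ⊆ outArcs S) (hB : ∀ u ∈ S, u.1 < B) (u : ℤ × ℤ) :
    winding Γ B u + winding Γ B (u + dir 0) = crossing Γ (u, 0) := by
  obtain ⟨x, y⟩ := u
  simp only [winding, dir, Matrix.cons_val_zero, Prod.mk_add_mk, add_zero]
  by_cases h : x < B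
  · have h1 : Finset.Ico x B = insert x (Finset.Ico (x + 1) B) := by
      ext j; simp only [Finset.mem_Ico, Finset.mem_insert]; omega
    rw [h1, Finset.sum_insert (by simp), add_assoc, CharTwo.add_self_eq_zero, add_zero]
  · rw [Finset.Ico_eq_empty h, Finset.Ico_eq_empty (by omega), crossing_eq_zero hΓ]
    · simp
    · refine iff_of_false (fun h' => h (hB _ h')) fun h' => ?_
      have := hB _ h'
      simp [Arc.tip, dir] at this
      omega

theorem winding_add_up (hΓ : Γ ⊆ outArcs S) (hnext : ∀ s ∈ outArcs S, next S s ∈ Γ ↔ s ∈ Γ)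
    (hB : ∀ u ∈ S, u.1 < B) (u : ℤ × ℤ) :
    winding Γ B u + winding Γ B (u + dir 2) = crossing Γ (u, 2) := by
  have base : ∀ u : ℤ × ℤ, B ≤ u.1 →
      winding Γ B u + winding Γ B (u + dir 2) = crossing Γ (u, 2) := by
    rintro ⟨x, y⟩ h
    simp only [winding, dir]
    rw [crossing_eq_zero hΓ]
    · simp [Finset.Ico_eq_empty (not_lt.2 h)]
    · refine iff_of_false (fun h' => (hB _ h').not_ge h) fun h' => ?_
      have := hB _ h'
      simp [Arc.tip, dir] at this h
      omega
  have step : ∀ u : ℤ × ℤ,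
      winding Γ B (u + dir 0) + winding Γ B (u + dir 0 + dir 2) = crossing Γ (u + dir 0, 2) →
      winding Γ B u + winding Γ B (u + dir 2) = crossing Γ (u, 2) := by
    intro u ih
    have h0 := winding_add_right hΓ hB u
    have h2 := winding_add_right hΓ hB (u + dir 2)
    have t0 := crossing_triangle hΓ hnext u 0
    have t1 := crossing_triangle hΓ hnext u 1
    have e : u + dir 2 + dir 0 = u + dir 0 + dir 2 := by abel
    have r := crossing_reverse Γ (u + dir 2, 0)
    have e' : Arc.tip (u + dir 2, 0) = u + dir 1 := by
      simp only [Arc.tip, add_assoc]; rfl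
    rw [e'] at r
    rw [e] at h2
    simp only [zero_add] at t0 r
    simp only [show (1 : Fin 6) + 2 = 3 from rfl, show (1 : Fin 6) + 1 = 2 from rfl] at t1
    rw [r] at t1
    generalize winding Γ B u = a at *
    generalize winding Γ B (u + dir 0) = b at *
    generalize winding Γ B (u + dir 2) = c at *
    generalize winding Γ B (u + dir 0 + dir 2) = d at *
    generalize crossing Γ (u, 0) = a' at *
    generalize crossing Γ (u, 1) = b' at *
    generalize crossing Γ (u, 2) = c' at *
    generalize crossing Γ (u + dir 0, 2) = d' at *
    generalize crossing Γ (u + dir 2, 0) = e' at *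
    subst h0 h2 ih
    clear * - t0 t1
    revert a b c d b' c'
    decide
  have key : ∀ (n : ℕ) (u : ℤ × ℤ), B ≤ u.1 + n →
      winding Γ B u + winding Γ B (u + dir 2) = crossing Γ (u, 2) := by
    intro n
    induction n with
    | zero => intro u hu; exact base u (by simpa using hu)
    | succ n ih =>
      intro u hu
      refine step u (ih _ ?_)
      simp only [dir, Matrix.cons_val_zero, Prod.fst_add]
      push_cast at hu
      omega
  exact key (B - u.1).toNat u (by omega)

theorem winding_add (hΓ : Γ ⊆ outArcs S) (hnext : ∀ s ∈ outArcs S, next S s ∈ Γ ↔ s ∈ Γ)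
    (hB : ∀ u ∈ S, u.1 < B) (u : ℤ × ℤ) (k : Fin 6) :
    winding Γ B u + winding Γ B (u + dir k) = crossing Γ (u, k) := by
  have pos : ∀ u, winding Γ B u + winding Γ B (u + dir 1) = crossing Γ (u, 1) := by
    intro u
    have h0 := winding_add_right hΓ hB u
    have h2 := winding_add_up hΓ hnext hB (u + dir 0)
    have t0 := crossing_triangle hΓ hnext u 0
    have e : u + dir 0 + dir 2 = u + dir 1 := by simp only [add_assoc]; rfl
    simp only [zero_add] at t0
    rw [← h0, ← h2, e] at t0
    rw [← CharTwo.add_eq_zero, ← t0]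
    linear_combination (- (1 : ZMod 2)) * CharTwo.add_self_eq_zero (winding Γ B (u + dir 0))
  have neg : ∀ u k, winding Γ B (u + dir k) + winding Γ B (u + dir k + dir (k + 3))
      = crossing Γ (u + dir k, k + 3) →
      winding Γ B u + winding Γ B (u + dir k) = crossing Γ (u, k) := by
    intro u k h
    have r := crossing_reverse Γ (u, k)
    rw [dir_add_three, add_neg_cancel_right] at h
    rw [← r, add_comm, h]
    rfl
  fin_cases k
  · exact winding_add_right hΓ hB u
  · exact pos u
  · exact winding_add_up hΓ hnext hB u
  · exact neg u 3 (winding_add_right hΓ hB _)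
  · exact neg u 4 (pos _)
  · exact neg u 5 (winding_add_up hΓ hnext hB _)

/-- Adjacency in the triangular lattice restricted to `S`. -/
def adjIn (S : Set (ℤ × ℤ)) (u v : ℤ × ℤ) : Prop := u ∈ S ∧ v ∈ S ∧ ∃ k, u + dir k = v

theorem winding_eq_of_adjIn (hΓ : Γ ⊆ outArcs S)
    (hnext : ∀ s ∈ outArcs S, next S s ∈ Γ ↔ s ∈ Γ) (hB : ∀ u ∈ S, u.1 < B) {u v : ℤ × ℤ}
    (h : Relation.ReflTransGen (adjIn S) u v) : winding Γ B v = winding Γ B u := by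
  induction h with
  | refl => rfl
  | @tail v w _ hvw ih =>
    obtain ⟨hv, hw, k, rfl⟩ := hvw
    have h := winding_add hΓ hnext hB v k
    rw [crossing_eq_zero hΓ (s := (v, k)) (iff_of_true hv hw), CharTwo.add_eq_zero] at h
    rw [← h, ih]

theorem winding_rightmost (hΓ : Γ ⊆ outArcs S) (hB : ∀ u ∈ S, u.1 < B) {x y : ℤ}
    (hx : (x, y) ∈ S) (hmax : ∀ j, x < j → (j, y) ∉ S) (hr : ((x, y), 0) ∈ Γ) :
    winding Γ B (x, y) = 1 := by
  rw [winding, Finset.sum_eq_single x]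
  · exact if_pos (Or.inl hr)
  · intro j hj hjx
    have hj' : x < j := lt_of_le_of_ne (Finset.mem_Ico.1 hj).1 (Ne.symm hjx)
    refine crossing_eq_zero hΓ (iff_of_false (hmax j hj') ?_)
    simp only [Arc.tip, dir, Matrix.cons_val_zero, Prod.mk_add_mk, add_zero]
    exact hmax _ (by omega)
  · intro h
    exact absurd (Finset.mem_Ico.2 ⟨le_rfl, hB _ hx⟩) h

theorem winding_eq_zero_of_column (hΓ : Γ ⊆ outArcs S)
    (hnext : ∀ s ∈ outArcs S, next S s ∈ Γ ↔ s ∈ Γ) (hB : ∀ u ∈ S, u.1 < B ∧ u.2 < B) {c : ℤ}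
    (hc : ∀ s ∈ Γ, s.1.1 ≠ c) (y : ℤ) : winding Γ B (c, y) = 0 := by
  have base : ∀ y, B ≤ y → winding Γ B (c, y) = 0 := by
    intro y hy
    refine Finset.sum_eq_zero fun j _ => crossing_eq_zero hΓ (iff_of_false ?_ ?_)
    · exact fun h => (hB _ h).2.not_ge hy
    · intro h
      have := (hB _ h).2
      simp [Arc.tip, dir] at this
      omega
  have key : ∀ (n : ℕ) (y : ℤ), B ≤ y + n → winding Γ B (c, y) = 0 := by
    intro n
    induction n with
    | zero => intro y hy; exact base y (by simpa using hy)
    | succ n ih =>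
      intro y hy
      have h := winding_add hΓ hnext (fun u hu => (hB u hu).1) (c, y) 2
      have hcr : crossing Γ ((c, y), 2) = 0 := by
        refine if_neg ?_
        rintro (h' | h')
        · exact hc _ h' rfl
        · exact hc _ h' (by simp [Arc.tip, dir])
      rw [hcr, CharTwo.add_eq_zero] at h
      rw [h]
      have : (c, y) + dir 2 = (c, y + 1) := by simp [dir]
      rw [this]
      exact ih _ (by push_cast at hy; omega)
  exact key (B - y).toNat y (by omega)

end Separation

theorem dir_fst_le_one : ∀ k : Fin 6, (dir k).1 ≤ 1 := by decide

theorem lt_minimalPeriod_next {S : Set (ℤ × ℤ)} (hS : S.Finite)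
    (hconn : ∀ u ∈ S, Relation.ReflTransGen (adjIn S) (0, 0) u) {m : ℕ} (hm : ((m : ℤ), 0) ∈ S)
    (hmax : ∀ j : ℤ, m < j → (j, 0) ∉ S) :
    m < Function.minimalPeriod (next S) (((m : ℤ), 0), 0) := by
  set r : Arc := (((m : ℤ), 0), 0) with hr_def
  have hr : r ∈ outArcs S := ⟨hm, by
    simp only [hr_def, Arc.tip, dir, Matrix.cons_val_zero, Prod.mk_add_mk, add_zero]
    exact hmax _ (by omega)⟩
  have hΓ := orbit_subset_outArcs hr
  have hnext : ∀ s ∈ outArcs S, next S s ∈ orbit S r ↔ s ∈ orbit S r :=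
    fun s hs => next_mem_orbit_iff hS hr hs
  obtain ⟨⟨b₁, b₂⟩, hb⟩ := hS.bddAbove
  set B := max b₁ b₂ + 1 with hB_def
  have hB : ∀ u ∈ S, u.1 < B ∧ u.2 < B := by
    intro u hu
    have h := hb hu
    have h1 : u.1 ≤ b₁ := h.1
    have h2 : u.2 ≤ b₂ := h.2
    constructor <;> omega
  have hB₁ : ∀ u ∈ S, u.1 < B := fun u hu => (hB u hu).1
  have hone : ∀ u ∈ S, winding (orbit S r) B u = 1 := by
    intro u hu
    rw [winding_eq_of_adjIn hΓ hnext hB₁ (hconn u hu),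
      ← winding_eq_of_adjIn hΓ hnext hB₁ (hconn _ hm)]
    exact winding_rightmost hΓ hB₁ hm hmax ⟨0, rfl⟩
  have hcol : ∀ c : ℕ, c ≤ m → ∃ s ∈ orbit S r, s.1.1 = c := by
    intro c hcm
    by_contra! hcon
    have hnot : ∀ u ∈ S, u.1 ≠ c := by
      rintro ⟨x, y⟩ hu rfl
      have h1 := hone _ hu
      rw [winding_eq_zero_of_column hΓ hnext hB hcon] at h1
      exact zero_ne_one h1
    have h0S : ((0, 0) : ℤ × ℤ) ∈ S := by
      rcases Relation.ReflTransGen.cases_head (hconn _ hm) with h | ⟨w, h, _⟩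
      · exact h ▸ hm
      · exact h.1
    have hleft : ∀ u, Relation.ReflTransGen (adjIn S) (0, 0) u → u.1 < c := by
      intro u hu
      induction hu with
      | refl =>
        have := hnot _ h0S
        simp only at this ⊢
        omega
      | @tail v w _ h ih =>
        obtain ⟨_, hw, k, rfl⟩ := h
        have h1 := hnot _ hw
        have hk : (dir k).1 ≤ 1 := dir_fst_le_one k
        simp only [Prod.fst_add] at h1 ⊢
        omega
    have := hleft _ (hconn _ hm)
    simp only at this
    omega
  have hsub : (Finset.range (m + 1)).image (fun c : ℕ => (c : ℤ)) ⊆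
      (Finset.range (Function.minimalPeriod (next S) r)).image
        (fun i => ((next S)^[i] r).1.1) := by
    intro c hc
    obtain ⟨c, hc, rfl⟩ := Finset.mem_image.1 hc
    obtain ⟨s, hs, hsc⟩ := hcol c (by simpa [Nat.lt_succ_iff] using hc)
    obtain ⟨i, hi, rfl⟩ := mem_orbit_iff_lt hS hr hs
    exact Finset.mem_image.2 ⟨i, Finset.mem_range.2 hi, hsc⟩
  have hcard := (Finset.card_le_card hsub).trans Finset.card_image_le
  rw [Finset.card_image_of_injective _ Nat.cast_injective, Finset.card_range,
    Finset.card_range] at hcard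
  exact hcard

theorem turn_false_iterate_five (s : Arc) : (turn false)^[5] s = (s.1, s.2 - 1) := by
  have h : ∀ k : Fin 6, k + 1 + 1 + 1 + 1 + 1 = k - 1 := by decide
  obtain ⟨u, k⟩ := s
  simp only [Function.iterate_succ, Function.iterate_zero, Function.comp, id, turn,
    Bool.false_eq_true, if_false, h]

theorem turn_true_iterate_five (s : Arc) :
    (turn true)^[5] s = (s.1 - dir (s.2 + 2), s.2 + 1) := by
  have h1 : ∀ k : Fin 6, dir (k + 1) + dir (k - 1 + 1) + dir (k - 1 - 1 + 1) +
      dir (k - 1 - 1 - 1 + 1) + dir (k - 1 - 1 - 1 - 1 + 1) = - dir (k + 2) := by decide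
  have h2 : ∀ k : Fin 6, k - 1 - 1 - 1 - 1 - 1 = k + 1 := by decide
  obtain ⟨u, k⟩ := s
  simp only [Function.iterate_succ, Function.iterate_zero, Function.comp, id, turn, if_true]
  rw [h2, sub_eq_add_neg u, ← h1]
  simp only [add_assoc]

theorem iterate_six_of_constant_side {S : Set (ℤ × ℤ)} {s : Arc} (hs : s ∈ outArcs S) {b : Bool}
    (h : ∀ j < 5, side S ((next S)^[j] s) = b) : (next S)^[6] s = s := by
  have hit : ∀ j ≤ 5, (next S)^[j] s = (turn b)^[j] s := by
    intro j
    induction j with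
    | zero => intro _; rfl
    | succ j ih =>
      intro hj
      rw [Function.iterate_succ_apply', Function.iterate_succ_apply', ← ih (by omega), next,
        h j (by omega)]
  rw [Function.iterate_succ_apply', hit 5 le_rfl]
  have h12 : s.2 + 1 + 1 = s.2 + 2 := by rw [add_assoc]; rfl
  cases b
  · rw [turn_false_iterate_five, next_of_notMem (by simpa [Arc.tip] using hs.2)]
    simp
  · rw [turn_true_iterate_five, next_of_mem (by simpa [h12] using hs.1)]
    simp [h12]

/-! ### Counting turn sequences -/

/-- The nonconstant Boolean words of length five. -/
def nonconstantWords : Finset (Fin 5 → Bool) := Finset.univ.filter fun b => ∃ i, b i ≠ b 0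

/-- Put a word of length five in front of a sequence. -/
def splice (b : Fin 5 → Bool) (τ : ℕ → Bool) (i : ℕ) : Bool :=
  if h : i < 5 then b ⟨i, h⟩ else τ (i - 5)

open Classical in
/-- Representatives of the words of length `n` without an aligned constant block of length five. -/
noncomputable def goodSeqs : ℕ → Finset (ℕ → Bool)
  | n + 5 => Finset.image₂ splice nonconstantWords (goodSeqs n)
  | 0 | 1 | 2 | 3 | 4 => Finset.univ.image fun b => splice b fun _ => false

open Classical in
theorem goodSeqs_of_lt {n : ℕ} (hn : n < 5) :
    goodSeqs n = Finset.univ.image fun b => splice b fun _ => false := by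
  interval_cases n <;> rw [goodSeqs]

open Classical in
theorem card_goodSeqs_le (n : ℕ) :
    ((goodSeqs n).card : ℝ) * (1 / 2) ^ n ≤ 32 * (99 / 100) ^ n := by
  induction n using Nat.strong_induction_on with
  | _ n ih =>
    rcases lt_or_ge n 5 with hn | hn
    · have h1 : (goodSeqs n).card ≤ 32 := by
        rw [goodSeqs_of_lt hn]
        exact Finset.card_image_le.trans (by simp)
      have h2 : ((1 : ℝ) / 2) ^ n ≤ (99 / 100) ^ n :=
        pow_le_pow_left₀ (by norm_num) (by norm_num) n
      exact mul_le_mul (by exact_mod_cast h1) h2 (by positivity) (by norm_num)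
    · obtain ⟨m, rfl⟩ : ∃ m, n = m + 5 := ⟨n - 5, by omega⟩
      have h1 : (goodSeqs (m + 5)).card ≤ 30 * (goodSeqs m).card := by
        rw [goodSeqs]
        refine (Finset.card_image₂_le _ _ _).trans (le_of_eq ?_)
        rw [show nonconstantWords.card = 30 from by decide]
      have h2 : ((goodSeqs (m + 5)).card : ℝ) ≤ 30 * (goodSeqs m).card := by exact_mod_cast h1
      have h3 := ih m (by omega)
      have h4 : (0 : ℝ) < (99 / 100) ^ m := by positivity
      calc ((goodSeqs (m + 5)).card : ℝ) * (1 / 2) ^ (m + 5)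
          ≤ (30 * (goodSeqs m).card) * (1 / 2) ^ (m + 5) := by gcongr
        _ = (15 / 16) * ((goodSeqs m).card * (1 / 2) ^ m) := by ring
        _ ≤ (15 / 16) * (32 * (99 / 100) ^ m) := by gcongr
        _ ≤ 32 * (99 / 100) ^ (m + 5) := by
            rw [pow_add]
            nlinarith

open Classical in
theorem exists_mem_goodSeqs (n : ℕ) (τ : ℕ → Bool)
    (h : ∀ i, i + 5 ≤ n → ∃ j < 5, τ (i + j) ≠ τ i) :
    ∃ σ ∈ goodSeqs n, ∀ i < n, σ i = τ i := by
  induction n using Nat.strong_induction_on generalizing τ with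
  | _ n ih =>
    rcases lt_or_ge n 5 with hn | hn
    · rw [goodSeqs_of_lt hn]
      refine ⟨_, Finset.mem_image_of_mem _ (Finset.mem_univ fun i : Fin 5 => τ i), fun i hi => ?_⟩
      simp [splice, hi.trans hn]
    · obtain ⟨m, rfl⟩ : ∃ m, n = m + 5 := ⟨n - 5, by omega⟩
      obtain ⟨σ, hσ, hσ'⟩ := ih m (by omega) (fun i => τ (i + 5)) fun i hi => by
        obtain ⟨j, hj, hne⟩ := h (i + 5) (by omega)
        exact ⟨j, hj, by rwa [add_right_comm]⟩
      refine ⟨splice (fun i : Fin 5 => τ i) σ, ?_, fun i hi => ?_⟩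
      · rw [goodSeqs]
        refine Finset.mem_image₂_of_mem ?_ hσ
        obtain ⟨j, hj, hne⟩ := h 0 (by omega)
        exact Finset.mem_filter.2 ⟨Finset.mem_univ _, ⟨j, hj⟩, by simpa using hne⟩
      · by_cases h5 : i < 5
        · simp [splice, h5]
        · rw [splice, dif_neg h5, hσ' _ (by omega), Nat.sub_add_cancel (by omega)]

/-- The sequence of arcs obtained from `r` by prescribed turns. -/
def walk (τ : ℕ → Bool) (r : Arc) : ℕ → Arc
  | 0 => r
  | i + 1 => turn (τ i) (walk τ r i)

theorem exists_walk_eq_iterate_next {S : Set (ℤ × ℤ)} (hS : S.Finite) {r : Arc}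
    (hr : r ∈ outArcs S) (h : 6 < Function.minimalPeriod (next S) r) (n : ℕ) :
    ∃ σ ∈ goodSeqs n, ∀ i ≤ n, walk σ r i = (next S)^[i] r := by
  obtain ⟨σ, hσ, hσ'⟩ := exists_mem_goodSeqs n (fun i => side S ((next S)^[i] r)) fun i _ => by
    by_contra! hcon
    have h6 := iterate_six_of_constant_side (iterate_next_mem_outArcs hr i)
      (b := side S ((next S)^[i] r)) fun j hj => by
        rw [← Function.iterate_add_apply, add_comm]; exact hcon j hj
    have hper : Function.IsPeriodicPt (next S) 6 r :=
      Function.isPeriodicPt_of_mem_periodicPts_of_isPeriodicPt_iterate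
        (mem_periodicPts_next hS hr) h6
    exact absurd (hper.minimalPeriod_le (by norm_num)) (by omega)
  refine ⟨σ, hσ, fun i => ?_⟩
  induction i with
  | zero => intro _; rfl
  | succ i ih =>
    intro hi
    rw [walk, ih (by omega), hσ' i (by omega), Function.iterate_succ_apply']
    rfl

/-! ### Edge statuses and circuit weights -/

/-- Edges of the triangular lattice, indexed like those of `ℤ³` by a base vertex and an axis. -/
abbrev TriEdge : Type := (ℤ × ℤ) × Fin 3

/-- Whether the direction is the projection of a positive coordinate direction of `ℤ³`. -/
def fwd : Fin 6 → Bool := ![true, false, true, false, true, false]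

/-- The coordinate axis of `ℤ³` that projects to a direction. -/
def axis : Fin 6 → Fin 3 := ![0, 2, 1, 0, 2, 1]

/-- The undirected edge underlying an arc. -/
def triEdge (s : Arc) : TriEdge := (if fwd s.2 then s.1 else s.tip, axis s.2)

theorem fwd_add_three (k : Fin 6) : fwd (k + 3) = !fwd k := by revert k; decide

theorem fwd_turn (b : Bool) (s : Arc) : fwd (turn b s).2 = !fwd s.2 := by
  have h1 : ∀ k, fwd (k - 1) = !fwd k := by decide
  have h2 : ∀ k, fwd (k + 1) = !fwd k := by decide
  cases b <;> simp [turn, h1, h2]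

theorem eq_or_reverse_of_triEdge_eq {s t : Arc} (h : triEdge s = triEdge t) :
    s = t ∨ s.1 = t.tip ∧ s.tip = t.1 ∧ fwd s.2 = !fwd t.2 := by
  have hax : ∀ k l, axis k = axis l → k = l ∨ k = l + 3 := by decide
  obtain ⟨u, k⟩ := s
  obtain ⟨v, l⟩ := t
  obtain ⟨h1, h2⟩ := Prod.ext_iff.1 h
  simp only [triEdge, Arc.tip] at h1 h2
  rcases hax k l h2 with rfl | rfl
  · left
    cases hk : fwd k <;> simp_all
  · right
    rw [fwd_add_three, dir_add_three] at h1
    simp only [Arc.tip, fwd_add_three, dir_add_three]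
    cases hl : fwd l <;> simp [hl] at h1 ⊢ <;> subst h1 <;> simp

/-- The weight of the event that the arc `s` is closed, given the statuses `st`: the bit of its
edge has to be the one that points against `s`. -/
noncomputable def arcWeight (p : ℝ) (st : TriEdge → Option Bool) (s : Arc) : ℝ≥0∞ :=
  (st (triEdge s)).elim (bitWeight p (!fwd s.2)) fun b => if b = !fwd s.2 then 1 else 0

/-- The weight of the event that all arcs of `Γ` are closed. -/
noncomputable def circuitWeight (p : ℝ) (st : TriEdge → Option Bool) (Γ : Finset Arc) : ℝ≥0∞ :=
  ∏ s ∈ Γ, arcWeight p st s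

theorem circuitWeight_split_le {p : ℝ} (hp0 : 0 ≤ p) (hp1 : p ≤ 1)
    {st : TriEdge → Option Bool} {e : TriEdge} (he : st e = none) (Γ : Finset Arc) :
    bitWeight p true * circuitWeight p (Function.update st e (some true)) Γ +
      bitWeight p false * circuitWeight p (Function.update st e (some false)) Γ
      ≤ circuitWeight p st Γ := by
  classical
  have hout : ∀ b, ∏ s ∈ Γ.filter (fun s => ¬ triEdge s = e),
      arcWeight p (Function.update st e (some b)) s
      = ∏ s ∈ Γ.filter (fun s => ¬ triEdge s = e), arcWeight p st s := fun b =>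
    Finset.prod_congr rfl fun s hs => by
      rw [arcWeight, Function.update_of_ne (Finset.mem_filter.1 hs).2, arcWeight]
  simp only [circuitWeight]
  simp only [← Finset.prod_filter_mul_prod_filter_not Γ (fun s => triEdge s = e), hout,
    ← mul_assoc, ← add_mul]
  refine mul_le_mul_left ?_ _
  set A := Γ.filter (fun s => triEdge s = e) with hA
  have hAe : ∀ s ∈ A, triEdge s = e := fun s hs => (Finset.mem_filter.1 hs).2
  rcases A.eq_empty_or_nonempty with h0 | ⟨s, hs⟩
  · simp [h0, bitWeight_true_add_false hp0 hp1]
  · have hzero : ∏ t ∈ A, arcWeight p (Function.update st e (some (fwd s.2))) t = 0 :=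
      Finset.prod_eq_zero hs (by simp [arcWeight, hAe s hs])
    have hone : bitWeight p (!fwd s.2) *
        ∏ t ∈ A, arcWeight p (Function.update st e (some (!fwd s.2))) t
        ≤ ∏ t ∈ A, arcWeight p st t := by
      by_cases hsing : ∀ t ∈ A, t = s
      · rw [Finset.eq_singleton_iff_unique_mem.2 ⟨hs, hsing⟩]
        simp [arcWeight, hAe s hs, he]
      · push Not at hsing
        obtain ⟨t, ht, hts⟩ := hsing
        rcases eq_or_reverse_of_triEdge_eq ((hAe t ht).trans (hAe s hs).symm) with h | ⟨_, _, h⟩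
        · exact absurd h hts
        · rw [Finset.prod_eq_zero ht (by simp [arcWeight, hAe t ht, h]), mul_zero]
          exact zero_le
    cases hb : fwd s.2 <;> simp only [hb, Bool.not_true, Bool.not_false] at hzero hone <;>
      simpa [hzero] using hone

theorem prod_bitWeight_alternating_le {p : ℝ} (hp0 : 0 ≤ p) (hp1 : p ≤ 1) {c : ℕ → Bool}
    (hc : ∀ i, c (i + 1) = !c i) (n : ℕ) :
    ∏ i ∈ Finset.range n, bitWeight p (c i) ≤ ENNReal.ofReal (2 * (1 / 2) ^ n) := by
  have hle : ∀ b, bitWeight p b ≤ 1 := by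
    intro b
    cases b <;> simp [bitWeight, hp0, hp1]
  have hmul : ∀ b, bitWeight p b * bitWeight p (!b) ≤ ENNReal.ofReal (1 / 4) := by
    intro b
    have h1 : ENNReal.ofReal p * ENNReal.ofReal (1 - p) ≤ ENNReal.ofReal (1 / 4) := by
      rw [← ENNReal.ofReal_mul hp0]
      exact ENNReal.ofReal_le_ofReal (by nlinarith [sq_nonneg (p - 1 / 2)])
    cases b
    · simpa [bitWeight, mul_comm] using h1
    · simpa [bitWeight] using h1
  induction n using Nat.twoStepInduction with
  | zero => simp
  | one => simpa using hle _
  | more n ih _ =>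
    rw [Finset.prod_range_succ, Finset.prod_range_succ, mul_assoc, hc]
    refine (mul_le_mul' ih (hmul _)).trans (le_of_eq ?_)
    rw [← ENNReal.ofReal_mul (by positivity)]
    congr 1
    ring

/-- The arc pointing right from `(m, 0)`. -/
def rightArc (m : ℕ) : Arc := (((m : ℤ), 0), 0)

open Classical in
/-- The total weight of the circuits of length at least `N` that leave the horizontal axis
at a point whose abscissa is smaller than their length. -/
noncomputable def potential (p : ℝ) (N : ℕ) (st : TriEdge → Option Bool) : ℝ≥0∞ :=
  ∑' j : ℕ, ∑ m ∈ Finset.range (j + N), ∑ τ ∈ goodSeqs (j + N),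
    if Set.InjOn (walk τ (rightArc m)) (Finset.range (j + N)) then
      circuitWeight p st ((Finset.range (j + N)).image (walk τ (rightArc m))) else 0

theorem potential_split_le {p : ℝ} (hp0 : 0 ≤ p) (hp1 : p ≤ 1) (N : ℕ)
    {st : TriEdge → Option Bool} {e : TriEdge} (he : st e = none) :
    bitWeight p true * potential p N (Function.update st e (some true)) +
      bitWeight p false * potential p N (Function.update st e (some false))
      ≤ potential p N st := by
  simp only [potential]
  rw [← ENNReal.tsum_mul_left, ← ENNReal.tsum_mul_left, ← ENNReal.tsum_add]
  refine ENNReal.tsum_le_tsum fun j => ?_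
  simp only [Finset.mul_sum, ← Finset.sum_add_distrib]
  refine Finset.sum_le_sum fun m _ => Finset.sum_le_sum fun τ _ => ?_
  split_ifs with h
  · exact circuitWeight_split_le hp0 hp1 he _
  · simp

theorem potential_none_le {p : ℝ} (hp0 : 0 ≤ p) (hp1 : p ≤ 1) (N : ℕ) :
    potential p N (fun _ => none) ≤
      ∑' j : ℕ, ENNReal.ofReal (64 * (((j + N : ℕ) : ℝ) * (99 / 100) ^ (j + N))) := by
  refine ENNReal.tsum_le_tsum fun j => ?_
  set L := j + N
  have hterm : ∀ m τ, (if Set.InjOn (walk τ (rightArc m)) (Finset.range L) then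
      circuitWeight p (fun _ => none) ((Finset.range L).image (walk τ (rightArc m))) else 0)
      ≤ ENNReal.ofReal (2 * (1 / 2) ^ L) := by
    intro m τ
    split_ifs with h
    · rw [circuitWeight, Finset.prod_image h]
      refine prod_bitWeight_alternating_le hp0 hp1
        (c := fun i => !fwd (walk τ (rightArc m) i).2) (fun i => ?_) L
      simp [walk, fwd_turn]
    · exact zero_le
  calc _ ≤ ∑ m ∈ Finset.range L, ∑ τ ∈ goodSeqs L, ENNReal.ofReal (2 * (1 / 2) ^ L) := by
        refine Finset.sum_le_sum fun m _ => Finset.sum_le_sum fun τ _ => ?_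
        convert hterm m τ
    _ = ENNReal.ofReal (L * ((goodSeqs L).card * (2 * (1 / 2) ^ L))) := by
        rw [Finset.sum_const, Finset.sum_const, Finset.card_range, nsmul_eq_mul, nsmul_eq_mul,
          ENNReal.ofReal_mul (Nat.cast_nonneg _), ENNReal.ofReal_mul (Nat.cast_nonneg _),
          ENNReal.ofReal_natCast, ENNReal.ofReal_natCast]
    _ ≤ _ := by
        refine ENNReal.ofReal_le_ofReal ?_
        have := card_goodSeqs_le L
        have hL : (0 : ℝ) ≤ L := by positivity
        nlinarith

theorem exists_potential_none_le {p : ℝ} (hp0 : 0 ≤ p) (hp1 : p ≤ 1) :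
    ∃ N, 6 ≤ N ∧ potential p N (fun _ => none) ≤ 1 / 2 := by
  have hsum : Summable fun n : ℕ => 64 * ((n : ℝ) * (99 / 100) ^ n) := by
    have := summable_pow_mul_geometric_of_norm_lt_one 1 (r := (99 / 100 : ℝ))
      (by rw [Real.norm_eq_abs, abs_of_pos] <;> norm_num)
    simpa using this.mul_left 64
  have h := ENNReal.tendsto_sum_nat_add _ hsum.tsum_ofReal_ne_top
  have h' := h.eventually (ge_mem_nhds (show (0 : ℝ≥0∞) < 1 / 2 by simp))
  obtain ⟨N, hN, hN6⟩ := (h'.and (Filter.eventually_ge_atTop 6)).exists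
  exact ⟨N, hN6, (potential_none_le hp0 hp1 N).trans hN⟩

theorem one_le_potential {p : ℝ} {N : ℕ} (hN : 6 ≤ N) {st : TriEdge → Option Bool}
    {S : Set (ℤ × ℤ)} (hS : S.Finite) (hconn : ∀ u ∈ S, Relation.ReflTransGen (adjIn S) (0, 0) u)
    (hNS : ((N : ℤ), 0) ∈ S) (hclosed : ∀ s ∈ outArcs S, st (triEdge s) = some (!fwd s.2)) :
    1 ≤ potential p N st := by
  classical
  obtain ⟨m, hm, hmmax⟩ : ∃ m : ℕ, ((m : ℤ), 0) ∈ S ∧ ∀ j : ℤ, m < j → (j, 0) ∉ S := by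
    have hfin : {j : ℕ | ((j : ℤ), (0 : ℤ)) ∈ S}.Finite :=
      hS.preimage (f := fun j : ℕ => ((j : ℤ), (0 : ℤ))) fun a _ b _ h => by simpa using h
    obtain ⟨m, hm, hmax⟩ := hfin.exists_le_maximal hNS |>.imp fun m h => h.2
    refine ⟨m, hm, fun j hj hjS => ?_⟩
    lift j to ℕ using by omega
    have := hmax hjS (by simpa using hj.le)
    simp at this hj
    omega
  have hNm : N ≤ m := by
    by_contra! h
    exact hmmax N (by exact_mod_cast h) hNS
  have hr : rightArc m ∈ outArcs S := ⟨hm, by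
    simp only [rightArc, Arc.tip, dir, Matrix.cons_val_zero, Prod.mk_add_mk, add_zero]
    exact hmmax _ (by omega)⟩
  have hmL : m < Function.minimalPeriod (next S) (rightArc m) :=
    lt_minimalPeriod_next hS hconn hm hmmax
  obtain ⟨σ, hσ, hwalk⟩ := exists_walk_eq_iterate_next hS hr (by omega)
    (Function.minimalPeriod (next S) (rightArc m))
  have hinj : Set.InjOn (walk σ (rightArc m))
      (Finset.range (Function.minimalPeriod (next S) (rightArc m))) := by
    intro a ha b hb hab
    rw [Finset.coe_range] at ha hb
    rw [hwalk a ha.le, hwalk b hb.le] at hab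
    exact Function.iterate_injOn_Iio_minimalPeriod ha hb hab
  have hweight : circuitWeight p st ((Finset.range (Function.minimalPeriod (next S)
      (rightArc m))).image (walk σ (rightArc m))) = 1 := by
    refine Finset.prod_eq_one fun s hs => ?_
    obtain ⟨i, hi, rfl⟩ := Finset.mem_image.1 hs
    rw [hwalk i (Finset.mem_range.1 hi).le]
    simp [arcWeight, hclosed _ (iterate_next_mem_outArcs hr i)]
  generalize Function.minimalPeriod (next S) (rightArc m) = L at *
  obtain ⟨j, rfl⟩ : ∃ j, L = j + N := ⟨L - N, by omega⟩
  refine le_trans ?_ (ENNReal.le_tsum j)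
  refine le_trans ?_ (Finset.single_le_sum (fun _ _ => zero_le) (Finset.mem_range.2 hmL))
  refine le_trans ?_ (Finset.single_le_sum (fun _ _ => zero_le) hσ)
  rw [if_pos hinj]
  refine hweight.symm.le.trans (le_of_eq ?_)
  congr

/-! ### Exploration of the cluster of the origin through its projection -/

/-- The projection of `ℤ³` along `(1, 1, 1)` onto the triangular lattice. -/
def proj (V : ℤ × ℤ × ℤ) : ℤ × ℤ := (V.1 - V.2.2, V.2.1 - V.2.2)

/-- The unit vectors of `ℤ³`, in the order of their projections. -/
def dir3 : Fin 6 → ℤ × ℤ × ℤ :=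
  ![(1, 0, 0), (0, 0, -1), (0, 1, 0), (-1, 0, 0), (0, 0, 1), (0, -1, 0)]

/-- The edge of `ℤ³` from `V` in a given direction. -/
def edge3 (V : ℤ × ℤ × ℤ) (k : Fin 6) : Edge3 := (if fwd k then V else V + dir3 k, axis k)

/-- The projection of an edge. -/
def projEdge (e : Edge3) : TriEdge := (proj e.1, e.2)

theorem proj_add_dir3 (V : ℤ × ℤ × ℤ) (k : Fin 6) : proj (V + dir3 k) = proj V + dir k := by
  obtain ⟨x, y, z⟩ := V
  fin_cases k <;> simp [proj, dir3, dir] <;> omega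

theorem projEdge_edge3 (V : ℤ × ℤ × ℤ) (k : Fin 6) :
    projEdge (edge3 V k) = triEdge (proj V, k) := by
  cases hk : fwd k <;> simp [projEdge, edge3, triEdge, Arc.tip, hk, proj_add_dir3]

theorem gStep3_of_edge3 {ω : Config3} {V : ℤ × ℤ × ℤ} {k : Fin 6}
    (h : ω (edge3 V k) = fwd k) : gStep3 ω V (V + dir3 k) := by
  refine ⟨edge3 V k, ?_⟩
  rw [h]
  obtain ⟨x, y, z⟩ := V
  fin_cases k <;> simp [e3Src, e3Dst, edge3, dir3, fwd, axis]

/-- The directed cluster of the origin. -/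
def cluster (ω : Config3) : Set (ℤ × ℤ × ℤ) := {V | Relation.ReflTransGen (gStep3 ω) (0, 0, 0) V}

/-- A stage of the exploration: on the configurations that agree with `η` on `H`, the points of
`S` are projections of points `lift u` in the cluster of the origin, and `st` records the bits
revealed on the lifts of triangular edges. -/
structure Exploration (N : ℕ) (S : Set (ℤ × ℤ)) (lift : ℤ × ℤ → ℤ × ℤ × ℤ)
    (st : TriEdge → Option Bool) (H : Finset Edge3) (η : Config3) : Prop where
  fresh : ∀ h ∈ H, ∀ s : Arc, triEdge s = projEdge h → st (triEdge s) = none →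
    s.1 ∈ S ∧ s.tip ∈ S
  proj_lift : ∀ u ∈ S, proj (lift u) = u
  lift_mem : ∀ u ∈ S, ∀ ω ∈ cylinder H η, lift u ∈ cluster ω
  tip_mem : ∀ s : Arc, st (triEdge s) = some (fwd s.2) → s.tip ∈ S
  segment : ((N : ℤ), 0) ∈ S
  connected : ∀ u ∈ S, Relation.ReflTransGen (adjIn S) (0, 0) u

namespace Exploration

variable {N : ℕ} {S : Set (ℤ × ℤ)} {lift : ℤ × ℤ → ℤ × ℤ × ℤ} {st : TriEdge → Option Bool}
  {H : Finset Edge3} {η : Config3}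

theorem edge3_notMem (h : Exploration N S lift st H η) {s : Arc} (hs : s ∈ outArcs S)
    (hst : st (triEdge s) = none) : edge3 (lift s.1) s.2 ∉ H := fun hH =>
  hs.2 (h.fresh _ hH s (by rw [projEdge_edge3, h.proj_lift _ hs.1]) hst).2

theorem cylinder_insert_subset {e : Edge3} (he : e ∉ H) (b : Bool) :
    cylinder (insert e H) (Function.update η e b) ⊆ cylinder H η := fun ω hω f hf => by
  rw [hω f (Finset.mem_insert_of_mem hf), Function.update_of_ne (ne_of_mem_of_not_mem hf he)]

theorem close (h : Exploration N S lift st H η) {s : Arc} (hs : s ∈ outArcs S)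
    (hst : st (triEdge s) = none) :
    Exploration N S lift (Function.update st (triEdge s) (some (!fwd s.2)))
      (insert (edge3 (lift s.1) s.2) H)
      (Function.update η (edge3 (lift s.1) s.2) (!fwd s.2)) where
  fresh := by
    intro f hf t ht hnone
    by_cases hts : triEdge t = triEdge s
    · simp [hts] at hnone
    rw [Function.update_of_ne hts] at hnone
    rcases Finset.mem_insert.1 hf with rfl | hf
    · exact absurd (by rw [ht, projEdge_edge3, h.proj_lift _ hs.1]) hts
    · exact h.fresh f hf t ht hnone
  proj_lift := h.proj_lift
  lift_mem u hu ω hω := h.lift_mem u hu ω (cylinder_insert_subset (h.edge3_notMem hs hst) _ hω)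
  tip_mem := by
    intro t ht
    by_cases hts : triEdge t = triEdge s
    · rcases eq_or_reverse_of_triEdge_eq hts with rfl | ⟨_, h2, _⟩
      · simp at ht
      · exact h2 ▸ hs.1
    · rw [Function.update_of_ne hts] at ht
      exact h.tip_mem t ht
  segment := h.segment
  connected := h.connected

theorem adjIn_mono {T : Set (ℤ × ℤ)} (hST : S ⊆ T) {u v : ℤ × ℤ} (h : adjIn S u v) :
    adjIn T u v := ⟨hST h.1, hST h.2.1, h.2.2⟩

theorem extend (h : Exploration N S lift st H η) {s : Arc} (hs : s ∈ outArcs S)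
    (hst : st (triEdge s) = none) :
    Exploration N (insert s.tip S) (Function.update lift s.tip (lift s.1 + dir3 s.2))
      (Function.update st (triEdge s) (some (fwd s.2)))
      (insert (edge3 (lift s.1) s.2) H)
      (Function.update η (edge3 (lift s.1) s.2) (fwd s.2)) where
  fresh := by
    intro f hf t ht hnone
    by_cases hts : triEdge t = triEdge s
    · simp [hts] at hnone
    rw [Function.update_of_ne hts] at hnone
    rcases Finset.mem_insert.1 hf with rfl | hf
    · exact absurd (by rw [ht, projEdge_edge3, h.proj_lift _ hs.1]) hts
    · exact (h.fresh f hf t ht hnone).imp (Or.inr ·) (Or.inr ·)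
  proj_lift := by
    intro u hu
    by_cases hus : u = s.tip
    · rw [hus, Function.update_self, proj_add_dir3, h.proj_lift _ hs.1, Arc.tip]
    · rw [Function.update_of_ne hus]
      exact h.proj_lift u (hu.resolve_left hus)
  lift_mem := by
    intro u hu ω hω
    have hω' := cylinder_insert_subset (h.edge3_notMem hs hst) _ hω
    by_cases hus : u = s.tip
    · rw [hus, Function.update_self]
      refine Relation.ReflTransGen.tail (h.lift_mem _ hs.1 ω hω') (gStep3_of_edge3 ?_)
      rw [hω _ (Finset.mem_insert_self _ _), Function.update_self]
    · rw [Function.update_of_ne hus]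
      exact h.lift_mem u (hu.resolve_left hus) ω hω'
  tip_mem := by
    intro t ht
    by_cases hts : triEdge t = triEdge s
    · rcases eq_or_reverse_of_triEdge_eq hts with rfl | ⟨_, h2, _⟩
      · exact Or.inl rfl
      · exact Or.inr (h2 ▸ hs.1)
    · rw [Function.update_of_ne hts] at ht
      exact Or.inr (h.tip_mem t ht)
  segment := Or.inr h.segment
  connected := by
    have hsub : S ⊆ insert s.tip S := Set.subset_insert _ _
    have hold : ∀ u ∈ S, Relation.ReflTransGen (adjIn (insert s.tip S)) (0, 0) u := fun u hu =>
      Relation.ReflTransGen.mono (fun _ _ => adjIn_mono hsub) _ _ (h.connected u hu)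
    rintro u (rfl | hu)
    · exact (hold _ hs.1).tail ⟨hsub hs.1, Set.mem_insert _ _, s.2, rfl⟩
    · exact hold u hu

end Exploration

theorem cylinder_subset_union {I : Type*} [DecidableEq I] (H : Finset I) (η : I → Bool) (e : I) :
    cylinder H η ⊆ cylinder (insert e H) (Function.update η e true) ∪
      cylinder (insert e H) (Function.update η e false) := by
  intro ω hω
  have key : ω ∈ cylinder (insert e H) (Function.update η e (ω e)) := by
    intro f hf
    by_cases hfe : f = e
    · rw [hfe, Function.update_self]
    · rw [Function.update_of_ne hfe]
      exact hω f ((Finset.mem_insert.1 hf).resolve_left hfe)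
  cases hb : ω e <;> rw [hb] at key
  · exact Or.inr key
  · exact Or.inl key

/-- The event that the cluster of the origin projects into `B`. -/
def confined (B : Finset (ℤ × ℤ)) : Set Config3 := {ω | ∀ V ∈ cluster ω, proj V ∈ B}

theorem Exploration.confined_inter_eq_empty {N : ℕ} {S : Set (ℤ × ℤ)}
    {lift : ℤ × ℤ → ℤ × ℤ × ℤ} {st : TriEdge → Option Bool} {H : Finset Edge3} {η : Config3}
    (h : Exploration N S lift st H η) {B : Finset (ℤ × ℤ)} {u : ℤ × ℤ} (hu : u ∈ S)
    (huB : u ∉ B) : confined B ∩ cylinder H η = ∅ :=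
  Set.eq_empty_of_forall_notMem fun ω hω =>
    huB (h.proj_lift u hu ▸ hω.1 _ (h.lift_mem u hu ω hω.2))

theorem Exploration.measure_confined_le {p : ℝ} (hp0 : 0 ≤ p) (hp1 : p ≤ 1) {N : ℕ} (hN : 6 ≤ N)
    (B : Finset (ℤ × ℤ)) {S : Set (ℤ × ℤ)} {lift : ℤ × ℤ → ℤ × ℤ × ℤ}
    {st : TriEdge → Option Bool} {H : Finset Edge3} {η : Config3}
    (h : Exploration N S lift st H η) :
    mu3 p (confined B ∩ cylinder H η) ≤ potential p N st * mu3 p (cylinder H η) := by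
  classical
  set E : Finset TriEdge := (B ×ˢ Finset.univ).image triEdge with hE
  induction hn : (E.filter fun e => st e = none).card using Nat.strong_induction_on
    generalizing S lift st H η with
  | _ n ih =>
  by_cases hex : ∃ s ∈ outArcs S, st (triEdge s) = none
  · obtain ⟨s, hs, hst⟩ := hex
    by_cases hsB : s.1 ∈ B
    · have hlt : ∀ b, (E.filter fun e =>
          Function.update st (triEdge s) (some b) e = none).card < n := by
        intro b
        rw [← hn]
        refine Finset.card_lt_card (Finset.ssubset_iff_of_subset ?_ |>.2 ⟨triEdge s, ?_, ?_⟩)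
        · intro e he
          rw [Finset.mem_filter] at he ⊢
          by_cases hes : e = triEdge s
          · simp [hes] at he
          · rwa [Function.update_of_ne hes] at he
        · exact Finset.mem_filter.2 ⟨Finset.mem_image_of_mem _
            (Finset.mem_product.2 ⟨hsB, Finset.mem_univ _⟩), hst⟩
        · simp
      set e := edge3 (lift s.1) s.2 with he
      have hbound : ∀ b, mu3 p (confined B ∩ cylinder (insert e H) (Function.update η e b)) ≤
          potential p N (Function.update st (triEdge s) (some b)) *
            (bitWeight p b * mu3 p (cylinder H η)) := by
        intro b
        rw [← mu3_cylinder_insert hp0 hp1 (h.edge3_notMem hs hst)]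
        rcases Bool.eq_or_eq_not b (fwd s.2) with rfl | rfl
        · exact ih _ (hlt _) (h.extend hs hst) rfl
        · exact ih _ (hlt _) (h.close hs hst) rfl
      calc mu3 p (confined B ∩ cylinder H η)
          ≤ mu3 p (confined B ∩ cylinder (insert e H) (Function.update η e true)) +
            mu3 p (confined B ∩ cylinder (insert e H) (Function.update η e false)) := by
            refine (measure_mono ?_).trans (measure_union_le _ _)
            rw [← Set.inter_union_distrib_left]
            exact Set.inter_subset_inter_right _ (cylinder_subset_union H η e)
        _ ≤ _ := add_le_add (hbound true) (hbound false)
        _ = (bitWeight p true * potential p N (Function.update st (triEdge s) (some true)) +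
              bitWeight p false * potential p N (Function.update st (triEdge s) (some false))) *
            mu3 p (cylinder H η) := by ring
        _ ≤ _ := mul_le_mul_left (potential_split_le hp0 hp1 N hst) _
    · rw [h.confined_inter_eq_empty hs.1 hsB, measure_empty]
      exact zero_le
  · push Not at hex
    by_cases hSB : S ⊆ B
    · have h1 : 1 ≤ potential p N st := by
        refine one_le_potential hN (B.finite_toSet.subset hSB) h.connected h.segment
          fun s hs => ?_
        obtain ⟨b, hb⟩ := Option.ne_none_iff_exists'.1 (hex s hs)
        rcases Bool.eq_or_eq_not b (fwd s.2) with rfl | rfl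
        · exact absurd (h.tip_mem s hb) hs.2
        · exact hb
      calc mu3 p (confined B ∩ cylinder H η) ≤ 1 * mu3 p (cylinder H η) := by
            rw [one_mul]; exact measure_mono Set.inter_subset_right
        _ ≤ _ := mul_le_mul_left h1 _
    · obtain ⟨u, hu, huB⟩ := Set.not_subset.1 hSB
      rw [h.confined_inter_eq_empty hu huB, measure_empty]
      exact zero_le

/-! ### Conclusion -/

/-- The edges of the segment from the origin to `(N, 0, 0)`. -/
def segmentEdges (N : ℕ) : Finset Edge3 :=
  (Finset.range N).image fun x : ℕ => (((x : ℤ), 0, 0), 0)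

theorem exploration_segment (N : ℕ) :
    Exploration N {u | u.2 = 0 ∧ 0 ≤ u.1 ∧ u.1 ≤ N} (fun u => (u.1, 0, 0)) (fun _ => none)
      (segmentEdges N) (fun _ => true) where
  fresh := by
    intro f hf s hs _
    obtain ⟨x, hx, rfl⟩ := Finset.mem_image.1 hf
    have hx := Finset.mem_range.1 hx
    have hs' : triEdge s = triEdge (((x : ℤ), 0), 0) := by
      rw [hs]; simp [projEdge, proj, triEdge, fwd, axis]
    rcases eq_or_reverse_of_triEdge_eq hs' with rfl | ⟨h1, h2, _⟩
    · simp [Arc.tip, dir]; omega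
    · simp [h1, h2]; simp [Arc.tip, dir]; omega
  proj_lift := by
    rintro ⟨x, y⟩ ⟨rfl, _, _⟩
    simp [proj]
  lift_mem := by
    rintro ⟨x, y⟩ ⟨rfl, h0, h1⟩ ω hω
    simp only at h0 h1 ⊢
    lift x to ℕ using h0
    induction x with
    | zero => exact Relation.ReflTransGen.refl
    | succ x ih =>
      refine Relation.ReflTransGen.tail (ih (by push_cast at h1; omega)) ?_
      have hx : (((x : ℤ), 0, 0), 0) ∈ segmentEdges N :=
        Finset.mem_image_of_mem _ (Finset.mem_range.2 (by push_cast at h1; omega))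
      exact ⟨(((x : ℤ), 0, 0), 0), Or.inl ⟨rfl, by simp [e3Dst], hω _ hx⟩⟩
  tip_mem := by simp
  segment := by simp
  connected := by
    rintro ⟨x, y⟩ ⟨rfl, h0, h1⟩
    simp only at h0 h1
    lift x to ℕ using h0
    induction x with
    | zero => exact Relation.ReflTransGen.refl
    | succ x ih =>
      push_cast at h1
      refine Relation.ReflTransGen.tail (ih (by omega)) ⟨?_, ?_, 0, ?_⟩
      · simp; omega
      · simp; omega
      · simp [dir]

theorem exists_mem_confined {ω : Config3} (h : (cluster ω).Finite) :
    ∃ R : ℕ, ω ∈ confined (Finset.Icc (-(R : ℤ), -(R : ℤ)) (R, R)) := by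
  obtain ⟨R, hR⟩ := (h.image fun V => max (proj V).1.natAbs (proj V).2.natAbs).bddAbove
  refine ⟨R, fun V hV => ?_⟩
  have := hR (Set.mem_image_of_mem _ hV)
  simp only [Finset.mem_Icc, Prod.le_def]
  omega

theorem confined_mono {B C : Finset (ℤ × ℤ)} (h : B ⊆ C) : confined B ⊆ confined C :=
  fun _ hω V hV => h (hω V hV)

theorem mu3_percolates_pos {p : ℝ} (hp0 : 0 < p) (hp1 : p ≤ 1) :
    0 < mu3 p {ω | percolates3 (gStep3 ω) Set.univ} := by
  obtain ⟨N, hN, hpot⟩ := exists_potential_none_le hp0.le hp1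
  set K := cylinder (segmentEdges N) fun _ => true with hK
  have hKpos : mu3 p K ≠ 0 := by
    rw [hK, mu3, bernoulliProduct_cylinder hp0.le hp1, Finset.prod_ne_zero_iff]
    simp [bitWeight, hp0]
  have hKtop : mu3 p K ≠ ∞ := by
    rw [hK, mu3, bernoulliProduct_cylinder hp0.le hp1]
    exact ENNReal.prod_ne_top fun _ _ => by simp [bitWeight]
  let D : ℕ → Set Config3 := fun R => confined (Finset.Icc (-(R : ℤ), -(R : ℤ)) (R, R)) ∩ K
  have hmono : Monotone D := fun R R' hR => Set.inter_subset_inter_left _ <| confined_mono <|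
    Finset.Icc_subset_Icc (by simpa [Prod.le_def] using hR) (by simpa [Prod.le_def] using hR)
  have hD : mu3 p (⋃ R, D R) ≤ 1 / 2 * mu3 p K := by
    rw [hmono.measure_iUnion]
    exact iSup_le fun R => ((exploration_segment N).measure_confined_le hp0.le hp1 hN _).trans
      (mul_le_mul_left hpot _)
  have hcover : K ⊆ (⋃ R, D R) ∪ {ω | percolates3 (gStep3 ω) Set.univ} := by
    intro ω hω
    by_cases hfin : (cluster ω).Finite
    · obtain ⟨R, hR⟩ := exists_mem_confined hfin
      exact Or.inl (Set.mem_iUnion.2 ⟨R, hR, hω⟩)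
    · exact Or.inr (percolates3_of_infinite hfin)
  rw [pos_iff_ne_zero]
  intro h0
  have hle : mu3 p K ≤ 1 / 2 * mu3 p K := by
    refine (measure_mono hcover).trans ((measure_union_le _ _).trans ?_)
    rw [h0, add_zero]
    exact hD
  rw [one_div, mul_comm, ← div_eq_mul_inv] at hle
  exact (ENNReal.half_lt_self hKpos hKtop).not_ge hle

theorem percolates3_of_forall_eq_false {ω : Config3} (h : ∀ e, ω e = false) :
    percolates3 (gStep3 ω) Set.univ := by
  refine ⟨fun n => (-(n : ℤ), 0, 0), by simp, fun a b hab => by simpa using hab, fun n => ?_,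
    fun _ => Set.mem_univ _⟩
  exact ⟨((-((n + 1 : ℕ) : ℤ), 0, 0), 0), Or.inr ⟨rfl, by simp [e3Dst], h _⟩⟩

theorem mu3_zero_percolates_pos : 0 < mu3 0 {ω | percolates3 (gStep3 ω) Set.univ} := by
  have huniv : mu3 0 Set.univ = 1 := by
    have h := bernoulliProduct_cylinder (I := Edge3) le_rfl zero_le_one ∅ fun _ => true
    simpa [cylinder, mu3] using h
  have hnull : mu3 0 (⋃ e : Edge3, cylinder {e} fun _ => true) = 0 := by
    refine measure_iUnion_null fun e => ?_
    rw [mu3, bernoulliProduct_cylinder le_rfl zero_le_one]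
    simp [bitWeight]
  have hcover : Set.univ ⊆ (⋃ e : Edge3, cylinder {e} fun _ => true) ∪
      {ω | percolates3 (gStep3 ω) Set.univ} := by
    intro ω _
    by_cases h : ∀ e, ω e = false
    · exact Or.inr (percolates3_of_forall_eq_false h)
    · push Not at h
      obtain ⟨e, he⟩ := h
      exact Or.inl (Set.mem_iUnion.2 ⟨e, by simpa [cylinder] using he⟩)
  rw [pos_iff_ne_zero]
  intro h0
  have := (measure_mono (μ := mu3 0) hcover).trans (measure_union_le _ _)
  simp [huniv, hnull, h0] at this

/-- For every `p ∈ [0,1]`, the `3`-dimensional Grimmett random-orientation model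
on `ℤ³` percolates: `θ_G³(p) > 0`. -/
theorem grimmett_3d_percolates (p : ℝ) (hp0 : 0 ≤ p) (hp1 : p ≤ 1) :
    0 < mu3 p {ω | percolates3 (gStep3 ω) Set.univ} := by
  rcases hp0.eq_or_lt with rfl | hp
  · exact mu3_zero_percolates_pos
  · exact mu3_percolates_pos hp hp1

end RandomOrientation
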